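/- The square-loss dual objective D is 1-strongly concave: for all α, α′ ∈ ℝⁿ and all t ∈ [0, 1], D(tα + (1 − t)α′) ≥ t·D(α) + (1 − t)·D(α′) + ½·t·(1 − t)·‖α − α′‖². -/

import Mathlib

open scoped Classical

/-- The square of a convex combination is at most the convex combination of the squares. -/
theorem sq_combo_le {t : ℝ} (a b : ℝ) (h0 : 0 ≤ t) (h1 : t ≤ 1) :
    (t * a + (1 - t) * b) ^ 2 ≤ t * a ^ 2 + (1 - t) * b ^ 2 := by
  nlinarith [mul_nonneg (mul_nonneg h0 (sub_nonneg.2 h1)) (sq_nonneg (a - b))]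

/-- The squared truncated absolute value `max (|x| - c) s ^ 2` is convex when `0 ≤ s`. -/
theorem sq_max_abs_sub_combo_le {c s t : ℝ} (u v : ℝ) (hs : 0 ≤ s) (h0 : 0 ≤ t) (h1 : t ≤ 1) :
    max (|t * u + (1 - t) * v| - c) s ^ 2 ≤
      t * max (|u| - c) s ^ 2 + (1 - t) * max (|v| - c) s ^ 2 := by
  have h1' : 0 ≤ 1 - t := sub_nonneg.2 h1
  refine le_trans (pow_le_pow_left₀ (le_max_of_le_right hs) ?_ 2) (sq_combo_le _ _ h0 h1)
  have habs : |t * u + (1 - t) * v| ≤ t * |u| + (1 - t) * |v| := by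
    simpa [abs_mul, abs_of_nonneg h0, abs_of_nonneg h1'] using abs_add_le (t * u) ((1 - t) * v)
  refine max_le ?_ ?_
  · linarith [mul_le_mul_of_nonneg_left (le_max_left (|u| - c) s) h0,
      mul_le_mul_of_nonneg_left (le_max_left (|v| - c) s) h1']
  · linarith [mul_le_mul_of_nonneg_left (le_max_right (|u| - c) s) h0,
      mul_le_mul_of_nonneg_left (le_max_right (|v| - c) s) h1']

/-- The square-loss dual objective D is 1-strongly concave: for all
α, α′ ∈ ℝⁿ, t ∈ [0,1]: D(tα + (1−t)α′) ≥ t·D(α) + (1−t)·D(α′) + ½t(1−t)‖α − α′‖². -/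
theorem statement_5 (l0 l1 l2 : ℝ) (hl0 : 0 < l0) (hl1 : 0 < l1) (hl2 : 0 < l2)
    (n p : ℕ) (X : Matrix (Fin n) (Fin p) ℝ) (y : Fin n → ℝ)
    (Φ : ℝ → ℝ)
    (hΦ : ∀ t : ℝ, Φ t =
      if 2 * Real.sqrt (l0 * l2) + l1 < |t| then l0 - (|t| - l1) ^ 2 / (4 * l2)
      else 0)
    (D : (Fin n → ℝ) → ℝ)
    (hD : ∀ α : Fin n → ℝ, D α =
      -(1 / 2) * (∑ i, (α i) ^ 2) - (∑ i, y i * α i)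
        + ∑ j, Φ (∑ i, X i j * α i)) :
    ∀ (α α' : Fin n → ℝ) (t : ℝ), 0 ≤ t → t ≤ 1 →
      D (fun i => t * α i + (1 - t) * α' i) ≥
        t * D α + (1 - t) * D α'
          + (1 / 2) * t * (1 - t) * (∑ i, (α i - α' i) ^ 2) := by
  intro α α' t h0 h1
  have hs : 0 ≤ 2 * Real.sqrt (l0 * l2) := by positivity
  have hΦ_max : ∀ x, Φ x = l0 - max (|x| - l1) (2 * Real.sqrt (l0 * l2)) ^ 2 / (4 * l2) := by
    intro x
    rw [hΦ]
    split_ifs with h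
    · rw [max_eq_left (by linarith)]
    · rw [max_eq_right (by linarith), mul_pow, Real.sq_sqrt (by positivity)]
      field_simp
      ring
  have hΦ_concave : ∀ u v, t * Φ u + (1 - t) * Φ v ≤ Φ (t * u + (1 - t) * v) := by
    intro u v
    simp only [hΦ_max]
    have h := div_le_div_of_nonneg_right
      (sq_max_abs_sub_combo_le (c := l1) u v hs h0 h1) (by positivity : 0 ≤ 4 * l2)
    rw [add_div, mul_div_assoc, mul_div_assoc] at h
    linarith
  have hsum : t * ∑ j, Φ (∑ i, X i j * α i) + (1 - t) * ∑ j, Φ (∑ i, X i j * α' i) ≤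
      ∑ j, Φ (∑ i, X i j * (t * α i + (1 - t) * α' i)) := by
    rw [Finset.mul_sum, Finset.mul_sum, ← Finset.sum_add_distrib]
    refine Finset.sum_le_sum fun j _ => (hΦ_concave _ _).trans_eq (congrArg Φ ?_)
    rw [Finset.mul_sum, Finset.mul_sum, ← Finset.sum_add_distrib]
    exact Finset.sum_congr rfl fun i _ => by ring
  have hlin : ∑ i, y i * (t * α i + (1 - t) * α' i) =
      t * ∑ i, y i * α i + (1 - t) * ∑ i, y i * α' i := by
    rw [Finset.mul_sum, Finset.mul_sum, ← Finset.sum_add_distrib]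
    exact Finset.sum_congr rfl fun i _ => by ring
  have hsq : ∑ i, (t * α i + (1 - t) * α' i) ^ 2 =
      t * ∑ i, α i ^ 2 + (1 - t) * ∑ i, α' i ^ 2 - t * (1 - t) * ∑ i, (α i - α' i) ^ 2 := by
    rw [Finset.mul_sum, Finset.mul_sum, Finset.mul_sum, ← Finset.sum_add_distrib,
      ← Finset.sum_sub_distrib]
    exact Finset.sum_congr rfl fun i _ => by ring
  simp only [hD]
  rw [hlin, hsq]
  linarith
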